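/- Martin's unraveling game for a closed payoff is clopen: in the auxiliary game T' constructed to unravel a closed game (T, P), the preimage [π]^{-1}(P) under the forgetful morphism π : T' → T is a clopen subset of [T']; in fact, membership in [π]^{-1}(P) is decided by the first two moves. -/

import Mathlib

universe u

namespace GS

variable {A B C : Type u}

/-- A tree on `A`: a set of finite sequences closed under prefixes. -/
def IsTree (T : Set (List A)) : Prop := ∀ ⦃x y : List A⦄, x <+: y → y ∈ T → x ∈ T

/-- A tree is pruned if every node has a proper extension in the tree. -/
def IsPruned (T : Set (List A)) : Prop := ∀ x ∈ T, ∃ a : A, x ++ [a] ∈ T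

/-- The body of a tree: infinite sequences all of whose finite prefixes lie in the tree. -/
def body (T : Set (List A)) : Set (ℕ → A) :=
  {a | ∀ n : ℕ, (List.ofFn fun i : Fin n => a i) ∈ T}

/-- The product of the discrete topologies on `ℕ → A`. -/
def seqTop (A : Type u) : TopologicalSpace (ℕ → A) :=
  @Pi.topologicalSpace ℕ (fun _ => A) (fun _ => ⊥)

/-- The subspace topology on the body of a tree. -/
def bodyTop (T : Set (List A)) : TopologicalSpace {a // a ∈ body T} :=
  TopologicalSpace.induced Subtype.val (seqTop A)

/-- A (functional) strategy for player `i` on the tree `T`: to each position of player `i`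
(i.e. of length `≡ i (mod 2)`) in `T` it assigns a legal move. -/
structure Strategy (T : Set (List A)) (i : ℕ) where
  move : List A → A
  legal : ∀ x ∈ T, x.length % 2 = i % 2 → x ++ [move x] ∈ T

/-- A play is consistent with a strategy of player `i` if all moves of player `i` are
given by the strategy. -/
def Consistent {T : Set (List A)} {i : ℕ} (σ : Strategy T i) (a : ℕ → A) : Prop :=
  ∀ n : ℕ, n % 2 = i % 2 → a n = σ.move (List.ofFn fun j : Fin n => a j)

/-- The plays (branches of the tree) consistent with a strategy; this is the body `[σ]`
of the strategy tree of `σ`. -/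
def plays {T : Set (List A)} {i : ℕ} (σ : Strategy T i) : Set (ℕ → A) :=
  {a ∈ body T | Consistent σ a}

/-- A strategy of player `i` is winning in the game `(T, P)` if every play consistent with it
is won by player `i`. -/
def WinningStrategy (T : Set (List A)) (P : Set (ℕ → A)) {i : ℕ} (σ : Strategy T i) : Prop :=
  ∀ a ∈ plays σ, if i % 2 = 0 then a ∈ P else a ∉ P

/-- A game is determined if one of the two players has a winning strategy. -/
def Determined (T : Set (List A)) (P : Set (ℕ → A)) : Prop :=
  (∃ σ : Strategy T 0, WinningStrategy T P σ) ∨ ∃ σ : Strategy T 1, WinningStrategy T P σ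

/-- The strategy tree of a functional strategy: all positions reachable while player `i`
follows `σ`. -/
def stratTree (T : Set (List A)) (i : ℕ) (σ : Strategy T i) : Set (List A) :=
  {x ∈ T | ∀ (y : List A) (a : A), y ++ [a] <+: x → y.length % 2 = i % 2 → a = σ.move y}

/-- A morphism of trees: an isotone, length-preserving map. -/
structure TreeHom (S : Set (List A)) (T : Set (List B)) where
  toFun : List A → List B
  mem : ∀ x ∈ S, toFun x ∈ T
  len : ∀ x ∈ S, (toFun x).length = x.length
  mono : ∀ ⦃x y : List A⦄, x ∈ S → y ∈ S → x <+: y → toFun x <+: toFun y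

/-- The identity tree morphism. -/
def TreeHom.id (S : Set (List A)) : TreeHom S S where
  toFun := _root_.id
  mem _ hx := hx
  len _ _ := rfl
  mono _ _ _ _ h := h

/-- Composition of tree morphisms. -/
def TreeHom.comp {S : Set (List A)} {T : Set (List B)} {U : Set (List C)}
    (g : TreeHom T U) (f : TreeHom S T) : TreeHom S U where
  toFun := g.toFun ∘ f.toFun
  mem x hx := g.mem _ (f.mem x hx)
  len x hx := by simp only [Function.comp_apply, g.len _ (f.mem x hx), f.len x hx]
  mono x y hx hy hxy := g.mono (f.mem x hx) (f.mem y hy) (f.mono hx hy hxy)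

/-- The map induced on infinite branches by a length-preserving isotone map of trees. -/
def bodyMap [Inhabited B] (f : List A → List B) (a : ℕ → A) : ℕ → B :=
  fun n => (f (List.ofFn fun i : Fin (n + 1) => a i)).getD n default

/-- A covering of trees: a tree morphism `π` together with a map `φ` of strategies (of either
player) satisfying the locality condition and the branch lifting condition. -/
structure Covering [Inhabited A] (S : Set (List B)) (T : Set (List A)) where
  π : TreeHom S T
  φ : ∀ i : ℕ, Strategy S i → Strategy T i
  agree : ∀ (i n : ℕ) (σ σ' : Strategy S i),
    (∀ x ∈ S, x.length ≤ n → σ.move x = σ'.move x) →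
    ∀ x ∈ T, x.length ≤ n → (φ i σ).move x = (φ i σ').move x
  lift : ∀ (i : ℕ) (σ : Strategy S i), ∀ a ∈ plays (φ i σ),
    ∃ a' ∈ plays σ, bodyMap π.toFun a' = a

/-- A covering is `k`-fixing if `π` restricts to a bijection on the first `k` levels and `φ` is
induced by `π` there. -/
structure IsFixing [Inhabited A] {S : Set (List B)} {T : Set (List A)} (k : ℕ)
    (c : Covering S T) : Prop where
  bij : Function.Bijective fun x : {x : List B // x ∈ S ∧ x.length ≤ k} =>
    (⟨c.π.toFun x.1, c.π.mem _ x.2.1, by rw [c.π.len _ x.2.1]; exact x.2.2⟩ :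
      {x : List A // x ∈ T ∧ x.length ≤ k})
  induced : ∀ (i : ℕ) (σ : Strategy S i), ∀ x ∈ S, x.length < k → x.length % 2 = i % 2 →
    c.π.toFun (x ++ [σ.move x]) = c.π.toFun x ++ [(c.φ i σ).move (c.π.toFun x)]

/-- A game `(T, P)` is unravelable if for every `k` there is a `k`-fixing covering of `T` such
that the preimage of `P` is clopen in the body of the covering tree. -/
def Unravelable [Inhabited A] (T : Set (List A)) (P : Set (ℕ → A)) : Prop :=
  ∀ k : ℕ, ∃ (B : Type u) (S : Set (List B)) (c : Covering S T),
    IsTree S ∧ IsPruned S ∧ S.Nonempty ∧ IsFixing k c ∧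
    @IsClopen _ (bodyTop S) {a : {a // a ∈ body S} | bodyMap c.π.toFun a.1 ∈ P}

/-- A game `(T, P)` is universally unravelable if for every covering of `T` the game with the
preimage of `P` as payoff set is unravelable. -/
def UnivUnravelable [Inhabited A] (T : Set (List A)) (P : Set (ℕ → A)) : Prop :=
  ∀ (B : Type u) (_ : Inhabited B) (S : Set (List B)) (c : Covering S T),
    IsTree S → IsPruned S → S.Nonempty →
    Unravelable S (bodyMap c.π.toFun ⁻¹' P)

end GS

namespace GS

section Prefixes

variable {A : Type u}

/-- The initial segment of length `n` of an infinite sequence. -/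
def pre (a : ℕ → A) (n : ℕ) : List A := List.ofFn fun i : Fin n => a i

@[simp] lemma length_pre (a : ℕ → A) (n : ℕ) : (pre a n).length = n := by simp [pre]

@[simp] lemma pre_zero (a : ℕ → A) : pre a 0 = [] := by simp [pre]

lemma pre_succ (a : ℕ → A) (n : ℕ) : pre a (n + 1) = pre a n ++ [a n] := by
  rw [pre, List.ofFn_succ', List.concat_eq_append]
  rfl

lemma pre_one (a : ℕ → A) : pre a 1 = [a 0] := by simp [pre_succ]

lemma pre_two (a : ℕ → A) : pre a 2 = [a 0, a 1] := by simp [pre_succ]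

lemma take_pre (a : ℕ → A) (n m : ℕ) : (pre a m).take n = pre a (min n m) := by
  apply List.ext_getElem
  · simp
  · intro k h₁ h₂
    simp [pre]

lemma pre_prefix (a : ℕ → A) {n m : ℕ} (h : n ≤ m) : pre a n <+: pre a m := by
  have := List.take_prefix n (pre a m)
  rwa [take_pre, min_eq_left h] at this

lemma getD_pre (a : ℕ → A) {n m : ℕ} (h : n < m) (d : A) : (pre a m).getD n d = a n := by
  have h' : n < (pre a m).length := by simpa using h
  rw [List.getD_eq_getElem _ _ h']
  simp [pre]

lemma pre_eq_iff {a b : ℕ → A} {n : ℕ} : pre a n = pre b n ↔ ∀ k < n, a k = b k := by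
  induction n with
  | zero => simp
  | succ n ih =>
    rw [pre_succ, pre_succ]
    constructor
    · intro h k hk
      have h' := List.append_inj' h rfl
      rcases Nat.lt_succ_iff_lt_or_eq.1 hk with hk | rfl
      · exact ih.1 h'.1 k hk
      · simpa using h'.2
    · intro h
      rw [ih.2 fun k hk => h k (by omega), h n (by omega)]

lemma map_pre {B : Type u} (f : A → B) (a : ℕ → A) (n : ℕ) :
    (pre a n).map f = pre (fun k => f (a k)) n := by
  simp [pre, List.map_ofFn, Function.comp_def]

/-- The tree of all positions reached through moves permitted by `L`. -/
def treeOf (L : List A → A → Prop) : Set (List A) := {l | ∀ p b, p ++ [b] <+: l → L p b}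

lemma isTree_treeOf (L : List A → A → Prop) : IsTree (treeOf L) :=
  fun _ _ hxy hy p b hp => hy p b (hp.trans hxy)

lemma nil_mem_treeOf (L : List A → A → Prop) : [] ∈ treeOf L := by
  intro p b h
  simp at h

lemma concat_mem_treeOf {L : List A → A → Prop} {p : List A} {b : A} :
    p ++ [b] ∈ treeOf L ↔ p ∈ treeOf L ∧ L p b := by
  constructor
  · intro h
    exact ⟨isTree_treeOf L (List.prefix_append _ _) h, h p b List.prefix_rfl⟩
  · rintro ⟨hp, hb⟩ q c hq
    rcases List.prefix_concat_iff.1 hq with h | h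
    · obtain ⟨rfl, h⟩ := List.append_inj' h rfl
      obtain rfl : c = b := by simpa using h
      exact hb
    · exact hp q c h

open Classical in
/-- The shortest initial segment of `x` in `U` (junk if there is none). -/
noncomputable def first (U : Set (List A)) (x : List A) : List A :=
  if h : ∃ n, x.take n ∈ U then x.take (Nat.find h) else []

lemma first_pre {U : Set (List A)} {a : ℕ → A} {n m : ℕ} (hnm : n ≤ m) (hn : pre a n ∈ U)
    (hmin : ∀ k < n, pre a k ∉ U) : first U (pre a m) = pre a n := by
  classical
  have h : ∃ k, (pre a m).take k ∈ U := ⟨n, by rwa [take_pre, min_eq_left hnm]⟩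
  have hf : Nat.find h = n := by
    rw [Nat.find_eq_iff]
    refine ⟨by rwa [take_pre, min_eq_left hnm], fun k hk => ?_⟩
    rw [take_pre, min_eq_left (by omega)]
    exact hmin k hk
  rw [first, dif_pos h, take_pre, hf, min_eq_left hnm]

lemma exists_take_pre {U : Set (List A)} {a : ℕ → A} {m : ℕ} :
    (∃ k, (pre a m).take k ∈ U) ↔ ∃ k ≤ m, pre a k ∈ U := by
  constructor
  · rintro ⟨k, hk⟩
    rw [take_pre] at hk
    exact ⟨_, min_le_right _ _, hk⟩
  · rintro ⟨k, hkm, hk⟩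
    exact ⟨k, by rwa [take_pre, min_eq_left hkm]⟩

end Prefixes

section Reachability

variable {A : Type u}

/-- The positions of `V` from which player `i` can force the play, as long as it stays in `V`,
to pass through `U`. -/
def Win (V U : Set (List A)) (i : ℕ) : Set (List A) :=
  {p | p ∈ V ∧ ∃ s : List A → A, (∀ q ∈ V, q ++ [s q] ∈ V) ∧
    ∀ a : ℕ → A, pre a p.length = p → (∀ n, p.length ≤ n → pre a n ∈ V) →
      (∀ n, p.length ≤ n → n % 2 = i % 2 → a n = s (pre a n)) → ∃ n, pre a n ∈ U}

variable {V U : Set (List A)} {i : ℕ}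

lemma win_of_turn {p : List A} {b : A} (hp : p ∈ V) (hi : p.length % 2 = i % 2)
    (hb : p ++ [b] ∈ Win V U i) : p ∈ Win V U i := by
  classical
  obtain ⟨hbV, s, hs, hw⟩ := hb
  refine ⟨hp, fun q => if q = p then b else s q, ?_, ?_⟩
  · intro q hq
    dsimp only
    split_ifs with h
    · rwa [h]
    · exact hs q hq
  · intro a ha haV hcons
    have h0 : a p.length = b := by
      have := hcons _ le_rfl hi
      simpa [ha] using this
    apply hw a
    · rw [List.length_append, List.length_singleton, pre_succ, ha, h0]
    · intro n hn
      exact haV n (by simp at hn; omega)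
    · intro n hn hni
      have hn' : p.length < n := by simp at hn; omega
      rw [hcons n hn'.le hni]
      refine if_neg ?_
      intro h
      have := congrArg List.length h
      simp at this
      omega

variable [Inhabited A]

lemma exists_legal (hV : IsPruned V) : ∃ s : List A → A, ∀ q ∈ V, q ++ [s q] ∈ V := by
  classical
  choose! s hs using hV
  exact ⟨s, hs⟩

lemma mem_win (hV : IsPruned V) {p : List A} (hp : p ∈ V) (hU : p ∈ U) : p ∈ Win V U i := by
  obtain ⟨s, hs⟩ := exists_legal hV
  exact ⟨hp, s, hs, fun a ha _ _ => ⟨_, ha ▸ hU⟩⟩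

lemma win_of_forall (hV : IsPruned V) {p : List A} (hp : p ∈ V)
    (hb : ∀ b, p ++ [b] ∈ V → p ++ [b] ∈ Win V U i) : p ∈ Win V U i := by
  classical
  obtain ⟨s₀, hs₀⟩ := exists_legal hV
  have : ∀ b, ∃ s : List A → A, (∀ q ∈ V, q ++ [s q] ∈ V) ∧ (p ++ [b] ∈ V →
    ∀ a : ℕ → A, pre a (p ++ [b]).length = p ++ [b] →
      (∀ n, (p ++ [b]).length ≤ n → pre a n ∈ V) →
      (∀ n, (p ++ [b]).length ≤ n → n % 2 = i % 2 → a n = s (pre a n)) → ∃ n, pre a n ∈ U) := by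
    intro b
    by_cases h : p ++ [b] ∈ V
    · obtain ⟨_, s, hs, hw⟩ := hb b h
      exact ⟨s, hs, fun _ => hw⟩
    · exact ⟨s₀, hs₀, fun h' => absurd h' h⟩
  choose s hs hw using this
  refine ⟨hp, fun q => s (q.getD p.length default) q, fun q hq => hs _ q hq, ?_⟩
  intro a ha haV hcons
  have hpa : pre a (p.length + 1) = p ++ [a p.length] := by rw [pre_succ, ha]
  refine hw (a p.length) ?_ a ?_ ?_ ?_
  · rw [← hpa]
    exact haV _ (by omega)
  · simpa using hpa
  · intro n hn
    exact haV n (by simp at hn; omega)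
  · intro n hn hni
    have hn' : p.length < n := by simp at hn; omega
    rw [hcons n hn'.le hni]
    dsimp only
    rw [getD_pre a hn']

open Classical in
/-- A strategy of player `i` forcing a visit to `U` from the position `p ∈ Win V U i`. -/
noncomputable def winMove (V U : Set (List A)) (i : ℕ) (p : List A) : List A → A :=
  if h : p ∈ Win V U i then h.2.choose else fun _ => default

lemma winMove_legal {p : List A} (h : p ∈ Win V U i) {q : List A} (hq : q ∈ V) :
    q ++ [winMove V U i p q] ∈ V := by
  rw [winMove, dif_pos h]
  exact h.2.choose_spec.1 q hq

lemma winMove_wins {p : List A} (h : p ∈ Win V U i) (a : ℕ → A) (ha : pre a p.length = p)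
    (haV : ∀ n, p.length ≤ n → pre a n ∈ V)
    (hcons : ∀ n, p.length ≤ n → n % 2 = i % 2 → a n = winMove V U i p (pre a n)) :
    ∃ n, pre a n ∈ U := by
  rw [winMove, dif_pos h] at hcons
  exact h.2.choose_spec.2 a ha haV hcons

end Reachability

section Unraveling

variable {A : Type u}

/-- The moves of the auxiliary game: a move of the original game together with a set of
positions, which is the quasistrategy played in the first two moves. -/
abbrev Node (A : Type u) : Type u := A × Set (List A)

variable (T : Set (List A)) (P : Set (ℕ → A))

/-- The positions having an extension in `P`. -/
def live : Set (List A) := {p | ∃ b ∈ body T, b ∈ P ∧ pre b p.length = p}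

/-- The positions comparable with `u`. -/
def compat (u : List A) : Set (List A) := {y ∈ T | y <+: u ∨ u <+: y}

/-- Quasistrategies of player `0`. -/
structure QuasiZero (Q : Set (List A)) : Prop where
  sub : Q ⊆ T
  move : ∀ p ∈ Q, p.length % 2 = 0 → ∃ a, p ++ [a] ∈ Q
  full : ∀ p ∈ Q, p.length % 2 = 1 → ∀ a, p ++ [a] ∈ T → p ++ [a] ∈ Q

/-- Quasistrategies of player `1` in the tree `Q` with all resulting plays in `P`. -/
structure QuasiOne (Q R : Set (List A)) : Prop where
  sub : R ⊆ Q
  live : R ⊆ live T P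
  full : ∀ p ∈ R, p.length % 2 = 0 → ∀ a, p ++ [a] ∈ Q → p ++ [a] ∈ R
  move : ∀ p ∈ R, p.length % 2 = 1 → ∃ a, p ++ [a] ∈ R

/-- Positions of `Q` from which player `1` wins every extension. -/
def decisive (Q : Set (List A)) : Set (List A) := {u | u ∈ Q ∧ u ∉ live T P ∧ 2 ≤ u.length}

/-- The admissible answers of player `1` to the quasistrategy `Q` of player `0`. -/
def Reply (Q R : Set (List A)) : Prop :=
  QuasiOne T P Q R ∨ ∃ u ∈ decisive T P Q, R = compat T u

/-- The legal moves of the auxiliary game. -/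
def Legal : List (Node A) → Node A → Prop
  | [], b => QuasiZero T b.2 ∧ [b.1] ∈ b.2
  | [c], b => Reply T P c.2 b.2 ∧ [c.1, b.1] ∈ b.2
  | c :: d :: q, b => (c :: d :: q).map Prod.fst ++ [b.1] ∈ d.2 ∧ b.2 = ∅

/-- The tree of the auxiliary game. -/
def aux : Set (List (Node A)) := treeOf (Legal T P)

variable {T P}

lemma Reply.sub {Q R : Set (List A)} (hQ : Q ⊆ T) (h : Reply T P Q R) : R ⊆ T := by
  rcases h with h | ⟨u, -, rfl⟩
  · exact h.sub.trans hQ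
  · exact fun _ hx => hx.1

lemma singleton_mem_aux {c : Node A} :
    [c] ∈ aux T P ↔ QuasiZero T c.2 ∧ [c.1] ∈ c.2 := by
  have := @concat_mem_treeOf _ (Legal T P) [] c
  simp only [List.nil_append, nil_mem_treeOf, true_and] at this
  exact this

lemma pair_mem_aux {c d : Node A} :
    [c, d] ∈ aux T P ↔ [c] ∈ aux T P ∧ Reply T P c.2 d.2 ∧ [c.1, d.1] ∈ d.2 :=
  @concat_mem_treeOf _ (Legal T P) [c] d

lemma concat_mem_aux {c d b : Node A} {q : List (Node A)} :
    (c :: d :: q) ++ [b] ∈ aux T P ↔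
      c :: d :: q ∈ aux T P ∧ (c :: d :: q).map Prod.fst ++ [b.1] ∈ d.2 ∧ b.2 = ∅ :=
  @concat_mem_treeOf _ (Legal T P) (c :: d :: q) b

lemma pair_mem_of_mem {c d : Node A} {q : List (Node A)} (h : c :: d :: q ∈ aux T P) :
    [c, d] ∈ aux T P :=
  isTree_treeOf _ ⟨q, rfl⟩ h

lemma map_mem_of_mem {c d : Node A} {q : List (Node A)} (h : c :: d :: q ∈ aux T P) :
    (c :: d :: q).map Prod.fst ∈ d.2 := by
  rcases List.eq_nil_or_concat q with rfl | ⟨q, b, rfl⟩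
  · exact (pair_mem_aux.1 h).2.2
  · rw [List.concat_eq_append] at h ⊢
    have := (concat_mem_aux.1 h).2.1
    simpa using this

lemma reply_sub {c d : Node A} (h : [c, d] ∈ aux T P) : d.2 ⊆ T := by
  rw [pair_mem_aux, singleton_mem_aux] at h
  exact h.2.1.sub h.1.1.sub

lemma map_fst_mem (hnil : [] ∈ T) : ∀ l ∈ aux T P, l.map Prod.fst ∈ T
  | [], _ => hnil
  | [_], h => (singleton_mem_aux.1 h).1.sub (singleton_mem_aux.1 h).2
  | _ :: _ :: _, h => reply_sub (pair_mem_of_mem h) (map_mem_of_mem h)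

lemma exists_concat_mem_compat (hT : IsTree T) (hpr : IsPruned T) {u p : List A} (hu : u ∈ T)
    (hp : p ∈ compat T u) : ∃ a, p ++ [a] ∈ compat T u := by
  rcases hp with ⟨hpT, h⟩
  have key : u <+: p → ∃ a, p ++ [a] ∈ compat T u := fun h => by
    obtain ⟨a, ha⟩ := hpr p hpT
    exact ⟨a, ha, Or.inr (h.trans (List.prefix_append _ _))⟩
  rcases h with ⟨t, rfl⟩ | h
  · rcases t with _ | ⟨a, t⟩
    · exact key (by simp)
    · have hpre : p ++ [a] <+: p ++ a :: t := ⟨t, by simp⟩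
      exact ⟨a, hT hpre hu, Or.inl hpre⟩
  · exact key h

lemma QuasiZero.isPruned (hpr : IsPruned T) {Q : Set (List A)} (h : QuasiZero T Q) :
    IsPruned Q := by
  intro p hp
  rcases Nat.mod_two_eq_zero_or_one p.length with h2 | h2
  · exact h.move p hp h2
  · obtain ⟨a, ha⟩ := hpr p (h.sub hp)
    exact ⟨a, h.full p hp h2 a ha⟩

lemma quasiZero_self (hpr : IsPruned T) : QuasiZero T T :=
  ⟨subset_rfl, fun p hp _ => hpr p hp, fun _ _ _ _ h => h⟩

lemma isPruned_aux (hT : IsTree T) (hpr : IsPruned T) (hnil : [] ∈ T) :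
    IsPruned (aux T P) := by
  rintro (_ | ⟨c, _ | ⟨d, q⟩⟩) hp
  · obtain ⟨a, ha⟩ := hpr [] hnil
    exact ⟨(a, T), singleton_mem_aux.2 ⟨quasiZero_self hpr, ha⟩⟩
  · obtain ⟨hQ, hc⟩ := singleton_mem_aux.1 hp
    suffices h : ∃ (a : A) (R : Set (List A)), Reply T P c.2 R ∧ [c.1, a] ∈ R by
      obtain ⟨a, R, h⟩ := h
      exact ⟨(a, R), pair_mem_aux.2 ⟨hp, h⟩⟩
    by_cases h : ∃ a t, c.1 :: a :: t ∈ decisive T P c.2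
    · obtain ⟨a, t, hu⟩ := h
      have hpre : [c.1, a] <+: c.1 :: a :: t := ⟨t, rfl⟩
      exact ⟨a, _, Or.inr ⟨_, hu, rfl⟩, hT hpre (hQ.sub hu.1), Or.inl hpre⟩
    · push Not at h
      obtain ⟨a, ha⟩ := hQ.isPruned hpr _ hc
      refine ⟨a, {p | p ∈ c.2 ∧ ∃ a t, p = c.1 :: a :: t}, Or.inl ⟨?_, ?_, ?_, ?_⟩,
        ha, a, [], rfl⟩
      · exact fun p hp => hp.1
      · rintro p ⟨hp, b, t, rfl⟩
        by_contra hl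
        exact h b t ⟨hp, hl, by simp⟩
      · rintro p ⟨hp, b, t, rfl⟩ - e he
        exact ⟨he, b, t ++ [e], by simp⟩
      · rintro p ⟨hp, b, t, rfl⟩ -
        obtain ⟨e, he⟩ := hQ.isPruned hpr _ hp
        exact ⟨e, he, b, t ++ [e], by simp⟩
  · suffices h : ∃ a, (c :: d :: q).map Prod.fst ++ [a] ∈ d.2 by
      obtain ⟨a, ha⟩ := h
      exact ⟨(a, ∅), concat_mem_aux.2 ⟨hp, ha, rfl⟩⟩
    have hm := map_mem_of_mem hp
    obtain ⟨hc, hR, -⟩ := pair_mem_aux.1 (pair_mem_of_mem hp)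
    have hQ := (singleton_mem_aux.1 hc).1
    rcases hR with hR | ⟨u, hu, hR⟩
    · rcases Nat.mod_two_eq_zero_or_one ((c :: d :: q).map Prod.fst).length with h2 | h2
      · obtain ⟨a, ha⟩ := hQ.move _ (hR.sub hm) h2
        exact ⟨a, hR.full _ hm h2 a ha⟩
      · exact hR.move _ hm h2
    · rw [hR] at hm ⊢
      exact exists_concat_mem_compat hT hpr (hQ.sub hu.1) hm

/-- The covering map, forgetting the quasistrategies. -/
def forget (hnil : [] ∈ T) : TreeHom (aux T P) T where
  toFun := List.map Prod.fst
  mem := map_fst_mem hnil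
  len _ _ := List.length_map _
  mono _ _ _ _ h := h.map _

lemma bodyMap_map_fst [Inhabited A] (a : ℕ → Node A) :
    bodyMap (List.map Prod.fst) a = fun n => (a n).1 := by
  funext n
  have : bodyMap (List.map Prod.fst) a n = ((pre a (n + 1)).map Prod.fst).getD n default := rfl
  rw [this, map_pre, getD_pre _ (Nat.lt_succ_self n)]

lemma mem_of_forall_live (hP : @IsClosed _ (bodyTop T) {a : {a // a ∈ body T} | a.1 ∈ P})
    {a : ℕ → A} (ha : a ∈ body T) (h : ∀ n, 2 ≤ n → pre a n ∈ live T P) : a ∈ P := by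
  by_contra haP
  let _ : TopologicalSpace A := ⊥
  obtain ⟨O, hO, hOeq⟩ := isOpen_induced_iff.1 hP.isOpen_compl
  have haO : a ∈ O := by
    have : (⟨a, ha⟩ : {a // a ∈ body T}) ∈ Subtype.val ⁻¹' O := by
      rw [hOeq]
      exact haP
    exact this
  obtain ⟨I, w, hw, hsub⟩ := isOpen_pi_iff.1 hO a haO
  obtain ⟨b, hb, hbP, hba⟩ := h (I.sup id + 2) (by omega)
  rw [length_pre, pre_eq_iff] at hba
  have hbO : b ∈ O := by
    apply hsub
    intro k hk
    have hk' : k ≤ I.sup id := Finset.le_sup (f := id) hk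
    rw [hba k (by omega)]
    exact (hw k hk).2
  have : (⟨b, hb⟩ : {a // a ∈ body T}) ∈ Subtype.val ⁻¹' O := hbO
  rw [hOeq] at this
  exact this hbP

lemma pre_mem_reply {a : ℕ → Node A} (ha : a ∈ body (aux T P)) {n : ℕ} (hn : 2 ≤ n) :
    pre (fun k => (a k).1) n ∈ (a 1).2 := by
  have h : pre a n ∈ aux T P := ha n
  obtain ⟨t, ht⟩ := pre_prefix a hn
  rw [pre_two] at ht
  rw [← map_pre, ← ht]
  rw [← ht] at h
  exact map_mem_of_mem h

lemma mem_payoff_iff (hnil : [] ∈ T)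
    (hP : @IsClosed _ (bodyTop T) {a : {a // a ∈ body T} | a.1 ∈ P})
    {a : ℕ → Node A} (ha : a ∈ body (aux T P)) :
    (fun n => (a n).1) ∈ P ↔ (a 1).2 ⊆ live T P := by
  have hb : (fun n => (a n).1) ∈ body T := by
    intro n
    have h := map_fst_mem hnil _ (ha n)
    have h' : (pre a n).map Prod.fst ∈ T := h
    rwa [map_pre] at h'
  have h2 : [a 0, a 1] ∈ aux T P := pre_two a ▸ ha 2
  obtain ⟨-, hR, -⟩ := pair_mem_aux.1 h2
  rcases hR with hR | ⟨u, hu, hR⟩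
  · exact iff_of_true (mem_of_forall_live hP hb fun n hn => hR.live (pre_mem_reply ha hn)) hR.live
  · have hpu : pre (fun n => (a n).1) u.length = u := by
      have := pre_mem_reply ha hu.2.2
      rw [hR] at this
      rcases this.2 with h | h
      · exact h.eq_of_length (by simp)
      · exact (h.eq_of_length (by simp)).symm
    have hl : ¬ (fun n => (a n).1) ∈ P := fun hp => hu.2.1 ⟨_, hb, hp, hpu⟩
    refine iff_of_false hl fun hsub => hu.2.1 (hsub ?_)
    rw [hR]
    exact ⟨hpu ▸ hb _, Or.inl List.prefix_rfl⟩

/-- The position of the auxiliary game lying over `x` with first two moves `D`. -/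
def liftPos (D : Node A × Node A) (x : List A) : List (Node A) :=
  (D.1 :: D.2 :: (x.drop 2).map fun y => (y, ∅)).take x.length

lemma length_liftPos_le (D : Node A × Node A) (x : List A) :
    (liftPos D x).length ≤ x.length := by
  simp [liftPos]

/-- The play of the auxiliary game lying over `a` with first two moves `D`. -/
def liftPlay (D : Node A × Node A) (a : ℕ → A) : ℕ → Node A
  | 0 => D.1
  | 1 => D.2
  | n + 2 => (a (n + 2), ∅)

lemma pre_liftPlay_add_two (D : Node A × Node A) (a : ℕ → A) (n : ℕ) :
    pre (liftPlay D a) (n + 2) = D.1 :: D.2 :: ((pre a (n + 2)).drop 2).map fun y => (y, ∅) := by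
  induction n with
  | zero => simp [pre_two, liftPlay]
  | succ n ih =>
    rw [pre_succ, ih, pre_succ a (n + 2),
      List.drop_append_of_le_length (by rw [length_pre]; omega), List.map_append]
    rfl

lemma pre_liftPlay (D : Node A × Node A) (a : ℕ → A) (n : ℕ) :
    pre (liftPlay D a) n = liftPos D (pre a n) := by
  rcases n with _ | _ | n
  · simp [liftPos]
  · simp [liftPos, pre_one, liftPlay]
  · rw [pre_liftPlay_add_two, liftPos, List.take_of_length_le]
    simp

/-- `D` is a pair of first moves over the play `a`, consistent with the strategy `σ`. -/
structure LiftData {i : ℕ} (σ : Strategy (aux T P) i) (a : ℕ → A) (D : Node A × Node A) :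
    Prop where
  mem : [D.1, D.2] ∈ aux T P
  fst : D.1.1 = a 0
  snd : D.2.1 = a 1
  zero : i % 2 = 0 → σ.move [] = D.1
  one : i % 2 = 1 → σ.move [D.1] = D.2

lemma exists_lift [Inhabited A] {i : ℕ} {σ : Strategy (aux T P) i} {a : ℕ → A}
    {D : Node A × Node A} (hD : LiftData σ a D)
    (hturn : ∀ m, 2 ≤ m → m % 2 = i % 2 → liftPos D (pre a m) ∈ aux T P →
      a m = (σ.move (liftPos D (pre a m))).1)
    (hother : ∀ m, 2 ≤ m → m % 2 ≠ i % 2 → pre a m ∈ D.2.2 → pre a (m + 1) ∈ D.2.2) :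
    ∃ a' ∈ plays σ, bodyMap (List.map Prod.fst) a' = a := by
  have hfst : (fun n => (liftPlay D a n).1) = a := by
    funext n
    rcases n with _ | _ | n
    · exact hD.fst
    · exact hD.snd
    · rfl
  have hlegal : ∀ n, pre (liftPlay D a) (n + 2) ∈ aux T P → (n + 2) % 2 = i % 2 →
      liftPlay D a (n + 2) = σ.move (pre (liftPlay D a) (n + 2)) ∧
        pre a (n + 2) ++ [a (n + 2)] ∈ D.2.2 := by
    intro n hn hi
    have hl := σ.legal _ hn (by simpa using hi)
    have ht := hturn (n + 2) (by omega) hi (pre_liftPlay D a _ ▸ hn)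
    rw [← pre_liftPlay] at ht
    rw [pre_liftPlay_add_two] at hl
    have hl := (concat_mem_aux.1 hl).2
    rw [← pre_liftPlay_add_two, map_pre, hfst, ← ht] at hl
    exact ⟨Prod.ext ht hl.2.symm, hl.1⟩
  have hmem : ∀ n, pre (liftPlay D a) (n + 2) ∈ aux T P := by
    intro n
    induction n with
    | zero => exact (pre_two _).symm ▸ hD.mem
    | succ n ih =>
      have hm : pre a (n + 2) ∈ D.2.2 := by
        have := ih
        rw [pre_liftPlay_add_two] at this
        have := map_mem_of_mem this
        rwa [← pre_liftPlay_add_two, map_pre, hfst] at this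
      have hn : pre a (n + 2) ++ [a (n + 2)] ∈ D.2.2 := by
        by_cases hi : (n + 2) % 2 = i % 2
        · exact (hlegal n ih hi).2
        · rw [← pre_succ]
          exact hother _ (by omega) hi hm
      rw [pre_succ, pre_liftPlay_add_two, concat_mem_aux, ← pre_liftPlay_add_two, map_pre, hfst]
      exact ⟨ih, hn, rfl⟩
  refine ⟨liftPlay D a, ⟨?_, ?_⟩, ?_⟩
  · intro n
    exact isTree_treeOf _ (pre_prefix _ (by omega : n ≤ n + 2)) (hmem n)
  · intro n hn
    change liftPlay D a n = σ.move (pre (liftPlay D a) n)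
    rcases n with _ | _ | n
    · rw [pre_zero, hD.zero hn.symm]
      rfl
    · rw [pre_one]
      exact (hD.one hn.symm).symm
    · exact (hlegal n (hmem n) hn).1
  · rw [bodyMap_map_fst, hfst]

variable [Inhabited A]

open Classical in
/-- Replace an illegal move at `x` by a legal one. -/
noncomputable def fixMove (T : Set (List A)) (x : List A) (a : A) : A :=
  if x ++ [a] ∈ T then a else if h : ∃ b, x ++ [b] ∈ T then h.choose else default

lemma fixMove_legal (hpr : IsPruned T) {x : List A} (hx : x ∈ T) (a : A) :
    x ++ [fixMove T x a] ∈ T := by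
  unfold fixMove
  split_ifs with h h'
  · exact h
  · exact h'.choose_spec
  · exact absurd (hpr x hx) h'

lemma fixMove_eq {x : List A} {a : A} (h : x ++ [a] ∈ T) : fixMove T x a = a := if_pos h

open Classical in
/-- The translated strategy: follow `h` over the first two moves `DN` as long as the opponent does
not enter `Win V U i`, then force a visit to `U`, and after the visit at `u` follow `h` over the
first two moves `Du u`. -/
noncomputable def response (h : List (Node A) → Node A) (i k : ℕ) (V U : Set (List A))
    (Du DN : List A → Node A × Node A) (x : List A) : A :=
  if ∃ n, x.take n ∈ U then (h (liftPos (Du (first U x)) x)).1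
  else if ∃ n, x.take n ∈ {p | p ∈ Win V U i ∧ k ≤ p.length} then
    winMove V U i (first {p | p ∈ Win V U i ∧ k ≤ p.length} x) x
  else (h (liftPos (DN x) x)).1

section Response

variable {h h' : List (Node A) → Node A} {i k : ℕ} {V U : Set (List A)}
  {Du DN : List A → Node A × Node A}

lemma response_congr {x : List A} (hh : ∀ l, l.length ≤ x.length → h l = h' l) :
    response h i k V U Du DN x = response h' i k V U Du DN x := by
  unfold response
  rw [hh _ (length_liftPos_le _ _), hh _ (length_liftPos_le _ _)]

lemma response_of_mem {a : ℕ → A} {n m : ℕ} (hnm : n ≤ m) (hn : pre a n ∈ U)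
    (hmin : ∀ k < n, pre a k ∉ U) :
    response h i k V U Du DN (pre a m) = (h (liftPos (Du (pre a n)) (pre a m))).1 := by
  rw [response, if_pos (exists_take_pre.2 ⟨n, hnm, hn⟩), first_pre hnm hn hmin]

lemma response_of_win {a : ℕ → A} {n m : ℕ} (hU : ∀ l ≤ m, pre a l ∉ U) (hnm : n ≤ m)
    (hn : pre a n ∈ Win V U i ∧ k ≤ n)
    (hmin : ∀ l < n, ¬ (pre a l ∈ Win V U i ∧ k ≤ l)) :
    response h i k V U Du DN (pre a m) = winMove V U i (pre a n) (pre a m) := by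
  rw [response, if_neg, if_pos (exists_take_pre.2 ⟨n, hnm, by simpa using hn⟩),
    first_pre hnm (by simpa using hn) (by simpa using hmin)]
  rw [exists_take_pre]
  push Not
  exact hU

lemma response_of_notMem {a : ℕ → A} {m : ℕ} (hU : ∀ l ≤ m, pre a l ∉ U)
    (hW : ∀ l ≤ m, ¬ (pre a l ∈ Win V U i ∧ k ≤ l)) :
    response h i k V U Du DN (pre a m) = (h (liftPos (DN (pre a m)) (pre a m))).1 := by
  rw [response, if_neg, if_neg]
  · rw [exists_take_pre]
    simpa using hW
  · rw [exists_take_pre]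
    push Not
    exact hU

lemma exists_lift_response {σ : Strategy (aux T P) i} (hσ : ∀ l ∈ aux T P, h l = σ.move l)
    (hfull : ∀ p ∈ V, p.length % 2 ≠ i % 2 → ∀ b, p ++ [b] ∈ T → p ++ [b] ∈ V) (hVT : V ⊆ T)
    {a : ℕ → A} (ha : a ∈ body T)
    (hcons : ∀ m, m % 2 = i % 2 →
      a m = fixMove T (pre a m) (response h i k V U Du DN (pre a m)))
    (hmem : ∀ n, pre a n ∈ U →
      LiftData σ a (Du (pre a n)) ∧ (Du (pre a n)).2.2 = compat T (pre a n))
    (hnot : (∀ n, pre a n ∉ U) → (∀ n, ¬ (pre a n ∈ Win V U i ∧ k ≤ n)) →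
      ∃ D, (∀ m, 2 ≤ m → DN (pre a m) = D) ∧ LiftData σ a D ∧
        ∀ m, 2 ≤ m → m % 2 ≠ i % 2 → pre a m ∈ D.2.2 → pre a (m + 1) ∈ D.2.2) :
    ∃ a' ∈ plays σ, bodyMap (List.map Prod.fst) a' = a := by
  classical
  have hlegal : ∀ D : Node A × Node A, LiftData σ a D → ∀ m, 2 ≤ m → m % 2 = i % 2 →
      liftPos D (pre a m) ∈ aux T P →
      pre a m ++ [(σ.move (liftPos D (pre a m))).1] ∈ D.2.2 := by
    intro D hD m hm hi hS
    obtain ⟨n, rfl⟩ : ∃ n, m = n + 2 := ⟨m - 2, by omega⟩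
    rw [← pre_liftPlay] at hS ⊢
    have hl := σ.legal _ hS (by simpa using hi)
    rw [pre_liftPlay_add_two] at hl
    have hl := (concat_mem_aux.1 hl).2.1
    rw [← pre_liftPlay_add_two, map_pre] at hl
    convert hl using 3
    funext k
    rcases k with _ | _ | k
    · exact hD.fst.symm
    · exact hD.snd.symm
    · rfl
  by_cases hU : ∃ n, pre a n ∈ U
  · have hn := Nat.find_spec hU
    have hmin : ∀ k < Nat.find hU, pre a k ∉ U := fun k hk => Nat.find_min hU hk
    generalize Nat.find hU = n at hn hmin
    obtain ⟨hD, hR⟩ := hmem n hn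
    refine exists_lift hD ?_ ?_
    · intro m hm hi hS
      have hl := hlegal _ hD m hm hi hS
      rcases lt_or_ge m n with hmn | hmn
      · rw [hR] at hl
        have hlen : (pre a m ++ [(σ.move (liftPos (Du (pre a n)) (pre a m))).1]).length
            = m + 1 := by simp
        have h1 : pre a m ++ [(σ.move (liftPos (Du (pre a n)) (pre a m))).1] <+: pre a n := by
          rcases hl.2 with h | h
          · exact h
          · refine (h.eq_of_length (le_antisymm h.length_le ?_)) ▸ List.prefix_rfl
            rw [hlen, length_pre]
            omega
        have h2 := List.prefix_of_prefix_length_le h1 (pre_prefix a hmn) (by simp)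
        have h3 := h2.eq_of_length (by simp)
        rw [pre_succ] at h3
        simpa using h3.symm
      · rw [← hσ _ hS] at hl ⊢
        conv_lhs => rw [hcons m hi, response_of_mem hmn hn hmin]
        exact fixMove_eq (reply_sub hD.mem hl)
    · intro m _ _ _
      rw [hR]
      refine ⟨ha _, ?_⟩
      rcases le_total (m + 1) n with h | h
      · exact Or.inl (pre_prefix a h)
      · exact Or.inr (pre_prefix a h)
  · push Not at hU
    by_cases hW : ∃ n, pre a n ∈ Win V U i ∧ k ≤ n
    · exfalso
      have hn := Nat.find_spec hW
      have hmin : ∀ l < Nat.find hW, ¬ (pre a l ∈ Win V U i ∧ k ≤ l) :=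
        fun l hl => Nat.find_min hW hl
      generalize Nat.find hW = n at hn hmin
      have hmove : ∀ m, n ≤ m → pre a m ∈ V → m % 2 = i % 2 →
          a m = winMove V U i (pre a n) (pre a m) := by
        intro m hm hmV hi
        rw [hcons m hi, response_of_win (fun l _ => hU l) hm hn hmin]
        exact fixMove_eq (hVT (winMove_legal hn.1 hmV))
      have hV : ∀ m, n ≤ m → pre a m ∈ V := by
        intro m hm
        induction m, hm using Nat.le_induction with
        | base => exact hn.1.1
        | succ m hm ih =>
          rw [pre_succ]
          by_cases hi : m % 2 = i % 2
          · rw [hmove m hm ih hi]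
            exact winMove_legal hn.1 ih
          · exact hfull _ ih (by simpa using hi) _ (pre_succ a m ▸ ha (m + 1))
      obtain ⟨m, hm⟩ := winMove_wins hn.1 a (by simp) (by simpa using hV)
        (by simpa using fun m hm hi => hmove m hm (hV m hm) hi)
      exact hU m hm
    · push Not at hW
      have hW' : ∀ n, ¬ (pre a n ∈ Win V U i ∧ k ≤ n) := fun n hn => (hW n hn.1).not_ge hn.2
      obtain ⟨D, hDN, hD, hother⟩ := hnot hU hW'
      refine exists_lift hD ?_ hother
      intro m hm hi hS
      have hl := hlegal _ hD m hm hi hS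
      rw [← hσ _ hS] at hl ⊢
      conv_lhs => rw [hcons m hi, response_of_notMem (fun l _ => hU l) (fun l _ => hW' l),
        hDN m hm]
      exact fixMove_eq (reply_sub hD.mem hl)

end Response

variable (T P)

/-- The translation of strategies of player `0`, where `c` is the first move. -/
noncomputable def moveZero (i : ℕ) (h : List (Node A) → Node A) (c : Node A) (x : List A) : A :=
  response h i 2 c.2 (decisive T P c.2)
    (fun u => (c, (u.getD 1 default, compat T u)))
    (fun y => (c, (y.getD 1 default,
      {p | p ∈ c.2 ∧ p ∉ Win c.2 (decisive T P c.2) i ∧ 2 ≤ p.length}))) x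

/-- The positions `u` that the strategy `f` of player `1` names in answer to the quasistrategy `Q`
of player `0`. -/
def Names (f : Node A → Node A) (u : List A) (Q : Set (List A)) : Prop :=
  [(u.getD 0 default, Q)] ∈ aux T P ∧ u ∈ decisive T P Q ∧
    (f (u.getD 0 default, Q)).2 = compat T u

open Classical in
/-- A quasistrategy of player `0` to which `f` answers by naming `u`. -/
noncomputable def witness (f : Node A → Node A) (u : List A) : Set (List A) :=
  if h : ∃ Q, Names T P f u Q then h.choose else ∅

/-- The quasistrategy of player `0` avoiding all positions from which player `1` can reach a
position named by `f`. -/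
def avoiding (i : ℕ) (f : Node A → Node A) : Set (List A) :=
  {p | p ∈ T ∧ p ∉ Win T {u | ∃ Q, Names T P f u Q} i ∧ 1 ≤ p.length}

/-- The translation of strategies of player `1`, where `f` is the answer to the first move. -/
noncomputable def moveOne (i : ℕ) (h : List (Node A) → Node A) (f : Node A → Node A)
    (x : List A) : A :=
  response h i 1 T {u | ∃ Q, Names T P f u Q}
    (fun u => ((u.getD 0 default, witness T P f u), f (u.getD 0 default, witness T P f u)))
    (fun y => ((y.getD 0 default, avoiding T P i f), f (y.getD 0 default, avoiding T P i f))) x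

open Classical in
/-- Restriction of a strategy to the positions of the auxiliary tree. -/
noncomputable def restr (s : List (Node A) → Node A) (l : List (Node A)) : Node A :=
  if l ∈ aux T P then s l else default

open Classical in
/-- The translation of strategies of either player. -/
noncomputable def transMove (i : ℕ) (s : List (Node A) → Node A) (x : List A) : A :=
  fixMove T x (if x.length % 2 = i % 2 then
    if i % 2 = 0 then moveZero T P i (restr T P s) (restr T P s []) x
    else moveOne T P i (restr T P s) (fun c => restr T P s [c]) x
  else default)

variable {T P}

lemma transMove_congr {i n : ℕ} {s s' : List (Node A) → Node A}
    (h : ∀ x ∈ aux T P, x.length ≤ n → s x = s' x) {x : List A} (hx : x.length ≤ n) :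
    transMove T P i s x = transMove T P i s' x := by
  have hr : ∀ l, l.length ≤ n → restr T P s l = restr T P s' l := by
    intro l hl
    unfold restr
    split_ifs with hm
    · exact h l hm hl
    · rfl
  unfold transMove
  congr 1
  split_ifs with h1 h2
  · rw [hr [] (by simp)]
    exact response_congr fun l hl => hr l (hl.trans hx)
  · have : (fun c => restr T P s [c]) = fun c => restr T P s' [c] := by
      funext c
      exact hr [c] (by simp; omega)
    rw [this]
    exact response_congr fun l hl => hr l (hl.trans hx)
  · rfl

lemma restr_eq {i : ℕ} (σ : Strategy (aux T P) i) :
    ∀ l ∈ aux T P, restr T P σ.move l = σ.move l := fun _ hl => if_pos hl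

lemma quasiOne_not_win (hpr : IsPruned T) {i : ℕ} (hi : i % 2 = 0) {Q : Set (List A)}
    (hQ : QuasiZero T Q) :
    QuasiOne T P Q {p | p ∈ Q ∧ p ∉ Win Q (decisive T P Q) i ∧ 2 ≤ p.length} := by
  have hQp := hQ.isPruned hpr
  refine ⟨fun p hp => hp.1, ?_, ?_, ?_⟩
  · rintro p ⟨hp, hw, h2⟩
    by_contra hl
    exact hw (mem_win hQp hp ⟨hp, hl, h2⟩)
  · rintro p ⟨hp, hw, h2⟩ hlen b hb
    exact ⟨hb, fun hbw => hw (win_of_turn hp (by omega) hbw), by simp; omega⟩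
  · rintro p ⟨hp, hw, h2⟩ hlen
    by_contra! hcon
    refine hw (win_of_forall hQp hp fun b hb => ?_)
    by_contra hbw
    exact hcon b ⟨hb, hbw, by simp; omega⟩

lemma quasiZero_avoiding (hpr : IsPruned T) {i : ℕ} (hi : i % 2 = 1) (f : Node A → Node A) :
    QuasiZero T (avoiding T P i f) := by
  refine ⟨fun p hp => hp.1, ?_, ?_⟩
  · rintro p ⟨hp, hw, h2⟩ hlen
    by_contra! hcon
    refine hw (win_of_forall hpr hp fun b hb => ?_)
    by_contra hbw
    exact hcon b ⟨hb, hbw, by simp⟩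
  · rintro p ⟨hp, hw, h2⟩ hlen b hb
    exact ⟨hb, fun hbw => hw (win_of_turn hp (by omega) hbw), by simp⟩

lemma exists_lift_zero (hpr : IsPruned T) {i : ℕ} (hi : i % 2 = 0)
    (σ : Strategy (aux T P) i) {a : ℕ → A} (ha : a ∈ body T)
    (hcons : ∀ m, m % 2 = i % 2 →
      a m = fixMove T (pre a m) (moveZero T P i (restr T P σ.move) (σ.move []) (pre a m))) :
    ∃ a' ∈ plays σ, bodyMap (List.map Prod.fst) a' = a := by
  have hc : [σ.move []] ∈ aux T P := σ.legal [] (nil_mem_treeOf _) (by simp [hi])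
  obtain ⟨hQ, hQ1⟩ := singleton_mem_aux.1 hc
  have ha0 : (σ.move []).1 = a 0 := by
    have h0 := hcons 0 (by omega)
    rw [moveZero, response_of_notMem] at h0
    · rw [pre_zero] at h0
      have : ∀ D : Node A × Node A, liftPos D ([] : List A) = [] := fun D => by simp [liftPos]
      rw [this, restr_eq σ _ (nil_mem_treeOf _), fixMove_eq (hQ.sub hQ1)] at h0
      exact h0.symm
    · intro l hl hmem
      have := hmem.2.2
      simp at this
      omega
    · rintro l hl ⟨-, h2⟩
      omega
  have ha1 : pre a 2 ∈ (σ.move []).2 := by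
    rw [pre_succ]
    refine hQ.full _ ?_ (by simp) _ ?_
    · rwa [pre_one, ← ha0]
    · exact pre_succ a 1 ▸ ha 2
  have hodd : ∀ p ∈ (σ.move []).2, p.length % 2 ≠ i % 2 →
      ∀ b, p ++ [b] ∈ T → p ++ [b] ∈ (σ.move []).2 :=
    fun p hp hl b hb => hQ.full p hp (by omega) b hb
  refine exists_lift_response (restr_eq σ) hodd hQ.sub ha hcons ?_ ?_
  · intro n hn
    have h2 : 2 ≤ n := by simpa using hn.2.2
    refine ⟨⟨pair_mem_aux.2 ⟨hc, Or.inr ⟨_, hn, rfl⟩, ?_⟩, ha0, getD_pre a h2 _,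
      fun _ => rfl, fun h => by omega⟩, rfl⟩
    rw [getD_pre a h2, ha0, ← pre_two]
    exact ⟨ha 2, Or.inl (pre_prefix a h2)⟩
  · intro _ hW
    have hW' : ∀ n, 2 ≤ n → pre a n ∉ Win (σ.move []).2 (decisive T P (σ.move []).2) i :=
      fun n h2 hn => hW n ⟨hn, h2⟩
    refine ⟨(σ.move [], (a 1, {p | p ∈ (σ.move []).2 ∧
      p ∉ Win (σ.move []).2 (decisive T P (σ.move []).2) i ∧ 2 ≤ p.length})), ?_, ?_, ?_⟩
    · intro m hm
      rw [getD_pre a hm]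
    · refine ⟨pair_mem_aux.2 ⟨hc, Or.inl (quasiOne_not_win hpr hi hQ), ?_⟩, ha0, rfl,
        fun _ => rfl, fun h => by omega⟩
      rw [ha0, ← pre_two]
      exact ⟨ha1, hW' 2 le_rfl, by simp⟩
    · rintro m hm hmi ⟨hmQ, -, -⟩
      refine ⟨?_, hW' _ (by omega), by simp; omega⟩
      rw [pre_succ]
      exact hodd _ hmQ (by simpa using hmi) _ (pre_succ a m ▸ ha (m + 1))

lemma exists_lift_one (hpr : IsPruned T) {i : ℕ} (hi : i % 2 = 1)
    (σ : Strategy (aux T P) i) {a : ℕ → A} (ha : a ∈ body T)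
    (hcons : ∀ m, m % 2 = i % 2 →
      a m = fixMove T (pre a m) (moveOne T P i (restr T P σ.move)
        (fun c => restr T P σ.move [c]) (pre a m))) :
    ∃ a' ∈ plays σ, bodyMap (List.map Prod.fst) a' = a := by
  refine exists_lift_response (restr_eq σ) (fun _ _ _ _ hb => hb) subset_rfl ha hcons ?_ ?_
  · intro n hn
    have hspec : Names T P (fun c => restr T P σ.move [c]) (pre a n)
        (witness T P (fun c => restr T P σ.move [c]) (pre a n)) := by
      have hn' : ∃ Q, Names T P (fun c => restr T P σ.move [c]) (pre a n) Q := hn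
      rw [witness, dif_pos hn']
      exact hn'.choose_spec
    generalize witness T P (fun c => restr T P σ.move [c]) (pre a n) = Q at hspec ⊢
    obtain ⟨hQ, hu, hR⟩ := hspec
    have h2 : 2 ≤ n := by simpa using hu.2.2
    dsimp only at hR ⊢
    rw [getD_pre a (by omega)] at hQ hR ⊢
    rw [restr_eq σ _ hQ] at hR ⊢
    have hl : [(a 0, Q), σ.move [(a 0, Q)]] ∈ aux T P := σ.legal _ hQ (by simp [hi])
    refine ⟨⟨hl, rfl, ?_, fun h => by omega, fun _ => rfl⟩, hR⟩
    have hm := (pair_mem_aux.1 hl).2.2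
    rw [hR] at hm
    have h1 : [a 0, (σ.move [(a 0, Q)]).1] <+: pre a n := by
      rcases hm.2 with h | h
      · exact h
      · rw [h.eq_of_length]
        have := h.length_le
        simp at this ⊢
        omega
    have h3 := (List.prefix_of_prefix_length_le h1 (pre_prefix a h2) (by simp)).eq_of_length
      (by simp)
    rw [pre_two] at h3
    simpa using h3
  · intro hU hW
    have hW' : ∀ n, 1 ≤ n → pre a n ∈ avoiding T P i fun c => restr T P σ.move [c] :=
      fun n h1 => ⟨ha n, fun hn => hW n ⟨hn, h1⟩, by simpa using h1⟩
    have hQ : QuasiZero T (avoiding T P i fun c => restr T P σ.move [c]) :=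
      quasiZero_avoiding hpr hi _
    have hav : ∀ u ∈ avoiding T P i (fun c => restr T P σ.move [c]),
        ¬ ∃ Q, Names T P (fun c => restr T P σ.move [c]) u Q :=
      fun u hu hex => hu.2.1 (mem_win hpr hu.1 hex)
    have h1 := hcons 1 (by omega)
    rw [moveOne, response_of_notMem (fun l _ => hU l) (fun l _ => hW l)] at h1
    generalize avoiding T P i (fun c => restr T P σ.move [c]) = Q at *
    have hc : [(a 0, Q)] ∈ aux T P := singleton_mem_aux.2 ⟨hQ, pre_one a ▸ hW' 1 le_rfl⟩
    have hl : [(a 0, Q), σ.move [(a 0, Q)]] ∈ aux T P := σ.legal _ hc (by simp [hi])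
    obtain ⟨-, hR, hm⟩ := pair_mem_aux.1 hl
    have hlift : ∀ D : Node A × Node A, liftPos D [a 0] = [D.1] := fun D => by simp [liftPos]
    have ha1 : (σ.move [(a 0, Q)]).1 = a 1 := by
      rw [pre_one, hlift] at h1
      simp only [List.getD_cons_zero] at h1
      rw [restr_eq σ _ hc, fixMove_eq (reply_sub hl hm)] at h1
      exact h1.symm
    refine ⟨((a 0, Q), σ.move [(a 0, Q)]), ?_, ⟨hl, rfl, ha1, fun h => by omega, fun _ => rfl⟩, ?_⟩
    · intro m hm
      dsimp only
      rw [getD_pre a (by omega), restr_eq σ _ hc]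
    · have hR' : QuasiOne T P Q (σ.move [(a 0, Q)]).2 := by
        refine hR.resolve_right ?_
        rintro ⟨u, hu, hRu⟩
        refine hav u hu.1 ⟨Q, ?_⟩
        have hu0 : u.getD 0 default = a 0 := by
          have h2 := hu.2.2
          rw [hRu] at hm
          rcases u with _ | ⟨b, u⟩
          · simp at h2
          · rcases hm.2 with h | h
            · simpa using (List.cons_prefix_cons.1 h).1.symm
            · simpa using (List.cons_prefix_cons.1 h).1
        unfold Names
        rw [hu0]
        exact ⟨hc, hu, (congrArg Prod.snd (restr_eq σ _ hc)).trans hRu⟩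
      intro m hm hmi hmR
      rw [pre_succ]
      exact hR'.full _ hmR (by simp; omega) _ (pre_succ a m ▸ hW' (m + 1) (by omega))

/-- The covering of `T` by the auxiliary tree. -/
noncomputable def unraveling (hpr : IsPruned T) (hnil : [] ∈ T) : Covering (aux T P) T where
  π := forget hnil
  φ i σ :=
    { move := transMove T P i σ.move
      legal := fun _ hx _ => fixMove_legal hpr hx _ }
  agree _ _ _ _ h _ _ hx := transMove_congr h hx
  lift i σ a ha := by
    obtain ⟨haT, hcons⟩ := ha
    rcases Nat.mod_two_eq_zero_or_one i with hi | hi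
    · refine exists_lift_zero hpr hi σ haT fun m hm => ?_
      have : a m = transMove T P i σ.move (pre a m) := hcons m hm
      rwa [transMove, if_pos (by simpa using hm), if_pos hi,
        restr_eq σ _ (nil_mem_treeOf _)] at this
    · refine exists_lift_one hpr hi σ haT fun m hm => ?_
      have : a m = transMove T P i σ.move (pre a m) := hcons m hm
      rwa [transMove, if_pos (by simpa using hm), if_neg (by omega)] at this

lemma isFixing_zero {B : Type u} {S : Set (List B)} (hS : [] ∈ S) (c : Covering S T) :
    IsFixing 0 c := by
  refine ⟨⟨?_, ?_⟩, fun _ _ _ _ h => absurd h (Nat.not_lt_zero _)⟩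
  · rintro ⟨x, _, hx⟩ ⟨y, _, hy⟩ -
    simp at hx hy
    simp [hx, hy]
  · rintro ⟨y, _, hy⟩
    refine ⟨⟨[], hS, le_rfl⟩, Subtype.ext ?_⟩
    have := c.π.len [] hS
    simp at hy this
    simp [hy, this]

lemma isClopen_second_move {B : Type u} (S : Set (List B)) (Y : Set B) :
    @IsClopen _ (bodyTop S) {a : {a // a ∈ body S} | a.1 1 ∈ Y} := by
  let _ : TopologicalSpace B := ⊥
  have : DiscreteTopology B := ⟨rfl⟩
  have hc : Continuous fun a : {a : ℕ → B // a ∈ body S} => a.1 1 :=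
    (continuous_apply 1).comp continuous_subtype_val
  exact (isClopen_discrete Y).preimage hc

end Unraveling

/-- Martin's unraveling of a closed game: there is a `0`-fixing covering of `T` such that the
preimage of the closed payoff set `P` is clopen; in fact membership in the preimage is decided
by the first two moves. -/
theorem unraveling_clopen {A : Type u} [Inhabited A] (T : Set (List A)) (P : Set (ℕ → A))
    (hT : IsTree T) (hpr : IsPruned T) (hne : T.Nonempty)
    (hP : @IsClosed _ (bodyTop T) {a : {a // a ∈ body T} | a.1 ∈ P}) :
    ∃ (B : Type u) (S : Set (List B)) (c : Covering S T),
      IsTree S ∧ IsPruned S ∧ S.Nonempty ∧ IsFixing 0 c ∧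
      @IsClopen _ (bodyTop S) {a : {a // a ∈ body S} | bodyMap c.π.toFun a.1 ∈ P} ∧
      ∀ a b : {a // a ∈ body S}, a.1 0 = b.1 0 → a.1 1 = b.1 1 →
        (bodyMap c.π.toFun a.1 ∈ P ↔ bodyMap c.π.toFun b.1 ∈ P) := by
  have hnil : [] ∈ T := by
    obtain ⟨x, hx⟩ := hne
    exact hT List.nil_prefix hx
  have hiff : ∀ a : {a // a ∈ body (aux T P)},
      bodyMap (unraveling (P := P) hpr hnil).π.toFun a.1 ∈ P ↔ (a.1 1).2 ⊆ live T P := by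
    intro a
    rw [← mem_payoff_iff hnil hP a.2, ← bodyMap_map_fst]
    rfl
  refine ⟨Node A, aux T P, unraveling hpr hnil, isTree_treeOf _, isPruned_aux hT hpr hnil,
    ⟨[], nil_mem_treeOf _⟩, isFixing_zero (nil_mem_treeOf _) _, ?_, ?_⟩
  · convert isClopen_second_move (aux T P) {b | b.2 ⊆ live T P} using 1
    ext a
    exact hiff a
  · intro a b _ h1
    rw [hiff, hiff, h1]
end GS
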